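/- Let σ ∈ (0,1), u(q) = q^σ/σ, B̂(σ) = ( σ^{−σ/(1−σ)} − σ − ln(1−σ) )^{−1}, and let F* be the probability measure on [0,σ] with density B̂(σ)/(1−z) on [0,σ) and a point mass of size 1 + B̂(σ)·ln(1−σ) at z = σ. Then for every linear cost function c(q) = γ·q with γ > 0, the expected buyer surplus under randomized constant shares equals exactly the fraction B̂(σ) of the efficient social surplus: ∫_{[0,σ]} U(c,z) dF*(z) = B̂(σ) · W(c), where U(c,z) = ((1−z)/σ)(z/γ)^{σ/(1−σ)} and W(c) = ((1−σ)/σ) γ^{−σ/(1−σ)}. -/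

import Mathlib

open Real Set MeasureTheory

noncomputable section

/-- exact constant ratio against linear costs under the randomized
constant share mechanism.  For `σ ∈ (0,1)`, `u(q) = q^σ/σ`,
`B̂(σ) = (σ^{−σ/(1−σ)} − σ − ln(1−σ))⁻¹`, and `F*` the probability measure on `[0,σ]`
with density `B̂(σ)/(1−z)` on `[0,σ)` and an atom of mass `1 + B̂(σ)·ln(1−σ)` at `σ`:
for every linear cost `c(q) = γ·q` with `γ > 0`,
`∫ U(c,z) dF*(z) = B̂(σ)·W(c)`, where `U(c,z) = ((1−z)/σ)(z/γ)^{σ/(1−σ)}` and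
`W(c) = ((1−σ)/σ) γ^{−σ/(1−σ)}`. -/
theorem stmt_15 (σ : ℝ) (hσ : σ ∈ Ioo (0:ℝ) 1)
    (u : ℝ → ℝ) (hu : ∀ q, u q = q ^ σ / σ)
    (Bhat : ℝ) (hBhat : Bhat = (σ ^ (-(σ / (1 - σ))) - σ - Real.log (1 - σ))⁻¹)
    (F : Measure ℝ)
    (hF : F = (volume.restrict (Ico 0 σ)).withDensity
        (fun z => ENNReal.ofReal (Bhat / (1 - z))) +
      (ENNReal.ofReal (1 + Bhat * Real.log (1 - σ))) • Measure.dirac σ)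
    (γ : ℝ) (hγ : 0 < γ)
    (U : ℝ → ℝ) (hU : ∀ z, U z = ((1 - z) / σ) * (z / γ) ^ (σ / (1 - σ)))
    (Wc : ℝ) (hWc : Wc = ((1 - σ) / σ) * γ ^ (-(σ / (1 - σ)))) :
    ∫ z, U z ∂F = Bhat * Wc := by
  obtain ⟨h0, h1⟩ := hσ
  have h1' : 0 < 1 - σ := by linarith
  set a := σ / (1 - σ) with ha
  set L := Real.log (1 - σ) with hL
  have ha0 : 0 < a := div_pos h0 h1'
  have ha1 : a + 1 = (1 - σ)⁻¹ := by rw [ha]; field_simp; ring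
  have hLneg : L < 0 := Real.log_neg h1' (by linarith)
  have hpow : 1 ≤ σ ^ (-a) :=
    Real.one_le_rpow_of_pos_of_le_one_of_nonpos h0 h1.le (by linarith)
  have hD : 0 < σ ^ (-a) - σ - L := by linarith
  have hB : 0 < Bhat := hBhat ▸ inv_pos.mpr hD
  have hBD : Bhat * (σ ^ (-a) - σ - L) = 1 := by rw [hBhat]; exact inv_mul_cancel₀ hD.ne'
  have hm : 0 ≤ 1 + Bhat * L := by nlinarith
  have hdens : Measurable fun z : ℝ => ENNReal.ofReal (Bhat / (1 - z)) := by fun_prop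
  have hfin : ∀ᵐ z ∂(volume.restrict (Ico 0 σ)), ENNReal.ofReal (Bhat / (1 - z)) < ⊤ :=
    .of_forall fun _ => ENNReal.ofReal_lt_top
  have hEq : EqOn (fun z => (ENNReal.ofReal (Bhat / (1 - z))).toReal • U z)
      (fun z => Bhat / σ * γ ^ (-a) * z ^ a) (Ico 0 σ) := by
    intro z hz
    have hz1 : 0 < 1 - z := by linarith [hz.2]
    simp only [smul_eq_mul]
    rw [ENNReal.toReal_ofReal (by positivity), hU, Real.div_rpow hz.1 hγ.le,
      Real.rpow_neg hγ.le]
    have := Real.rpow_pos_of_pos hγ a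
    field_simp
  have hInt : IntervalIntegrable (fun z : ℝ => z ^ a) volume 0 σ :=
    intervalIntegral.intervalIntegrable_rpow' (by linarith)
  have hIntOn : IntegrableOn (fun z : ℝ => Bhat / σ * γ ^ (-a) * z ^ a) (Ico 0 σ) := by
    rw [integrableOn_Ico_iff_integrableOn_Ioo, ← integrableOn_Ioc_iff_integrableOn_Ioo]
    exact ((intervalIntegrable_iff_integrableOn_Ioc_of_le h0.le).1 hInt).const_mul _
  have hcont : Integrable U ((volume.restrict (Ico 0 σ)).withDensity
      fun z => ENNReal.ofReal (Bhat / (1 - z))) := by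
    rw [integrable_withDensity_iff_integrable_smul' hdens hfin]
    exact hIntOn.congr_fun hEq.symm measurableSet_Ico
  have hatom : Integrable U (ENNReal.ofReal (1 + Bhat * L) • Measure.dirac σ) :=
    (integrable_dirac (by simp)).smul_measure ENNReal.ofReal_ne_top
  have hI : ∫ z in Ico 0 σ, z ^ a = σ ^ (a + 1) / (a + 1) := by
    rw [integral_Ico_eq_integral_Ioo, ← integral_Ioc_eq_integral_Ioo,
      ← intervalIntegral.integral_of_le h0.le, integral_rpow (Or.inl (by linarith)),
      Real.zero_rpow (by linarith), sub_zero]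
  rw [hF, integral_add_measure hcont hatom,
    integral_withDensity_eq_integral_toReal_smul hdens hfin,
    setIntegral_congr_fun measurableSet_Ico hEq, integral_const_mul, hI, integral_smul_measure,
    integral_dirac, ENNReal.toReal_ofReal hm, hU, hWc, Real.div_rpow h0.le hγ.le,
    Real.rpow_neg hγ.le, Real.rpow_add_one h0.ne', ha1, smul_eq_mul]
  have hinv : σ ^ (-a) * σ ^ a = 1 := by
    rw [← Real.rpow_add h0, neg_add_cancel, Real.rpow_zero]
  have hγa := Real.rpow_pos_of_pos hγ a
  field_simp
  linear_combination Bhat * hinv - σ ^ a * hBD
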